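/- arXiv:2008.02201 — 3 statements merged into one kernel-verified Lean document; each statement's English description precedes it below -/
import Mathlib

section
/- Let Z : ℝ³ → ℝ³ be defined on the infinite square cylinder {x ∈ ℝ³ : max(|x₁|,|x₂|) ≤ 1} by Z(x₁,x₂,x₃) = e^{x₃}·h(x₁,x₂), where h(u₁,u₂) = (u₁, u₂, 1 − max(|u₁|,|u₂|)). Then the image of the cylinder under Z equals the closed upper half-space with the origin removed, i.e. {y ∈ ℝ³ : y₃ ≥ 0} \ {0}. -/
/-- The Zorich map `Z(x₁,x₂,x₃) = e^{x₃} · (x₁, x₂, 1 − max (|x₁|, |x₂|))` on the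
infinite square cylinder. -/
noncomputable def zorich (x : EuclideanSpace ℝ (Fin 3)) : EuclideanSpace ℝ (Fin 3) :=
  Real.exp (x 2) •
    (WithLp.equiv 2 (Fin 3 → ℝ)).symm ![x 0, x 1, 1 - max |x 0| |x 1|]

theorem zorich_apply_zero (x : EuclideanSpace ℝ (Fin 3)) :
    zorich x 0 = Real.exp (x 2) * x 0 := by
  simp [zorich]

theorem zorich_apply_one (x : EuclideanSpace ℝ (Fin 3)) :
    zorich x 1 = Real.exp (x 2) * x 1 := by
  simp [zorich]

theorem zorich_apply_two (x : EuclideanSpace ℝ (Fin 3)) :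
    zorich x 2 = Real.exp (x 2) * (1 - max |x 0| |x 1|) := by
  simp [zorich]

theorem zorich_image_cylinder :
    zorich '' {x : EuclideanSpace ℝ (Fin 3) | max |x 0| |x 1| ≤ 1} =
      {y : EuclideanSpace ℝ (Fin 3) | 0 ≤ y 2} \ {0} := by
  ext y
  constructor
  · rintro ⟨x, hx, rfl⟩
    have hx' : max |x 0| |x 1| ≤ 1 := hx
    have he := Real.exp_pos (x 2)
    refine ⟨?_, ?_⟩
    · show 0 ≤ zorich x 2
      rw [zorich_apply_two]
      exact mul_nonneg he.le (by linarith)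
    · intro h
      have h' : zorich x = 0 := h
      have h0 := zorich_apply_zero x
      have h1 := zorich_apply_one x
      have h2 := zorich_apply_two x
      rw [h'] at h0 h1 h2
      have e0 : x 0 = 0 := by simpa [he.ne'] using h0
      have e1 : x 1 = 0 := by simpa [he.ne'] using h1
      rw [e0, e1] at h2
      simp at h2
      exact he.ne h2
  · rintro ⟨hy, hne⟩
    have hy' : 0 ≤ y 2 := hy
    have hm : 0 ≤ max |y 0| |y 1| := (abs_nonneg _).trans (le_max_left _ _)
    have hs : 0 < y 2 + max |y 0| |y 1| := by
      rcases (add_nonneg hy' hm).lt_or_eq with h | h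
      · exact h
      · exfalso
        apply hne
        have h2 : y 2 = 0 := by linarith
        have h0 : |y 0| ≤ 0 := by linarith [le_max_left |y 0| |y 1|]
        have h1 : |y 1| ≤ 0 := by linarith [le_max_right |y 0| |y 1|]
        show y = 0
        ext i
        fin_cases i
        · simpa using h0
        · simpa using h1
        · simpa using h2
    set s := y 2 + max |y 0| |y 1| with hsd
    have hmax : max |y 0 / s| |y 1 / s| = max |y 0| |y 1| / s := by
      rw [abs_div, abs_div, abs_of_pos hs, max_div_div_right hs.le]
    refine ⟨!₂[y 0 / s, y 1 / s, Real.log s], ?_, ?_⟩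
    · show max |y 0 / s| |y 1 / s| ≤ 1
      rw [hmax, div_le_one hs]
      linarith
    · ext i
      fin_cases i
      · refine (zorich_apply_zero _).trans ?_
        show Real.exp (Real.log s) * (y 0 / s) = y 0
        rw [Real.exp_log hs]
        field_simp
      · refine (zorich_apply_one _).trans ?_
        show Real.exp (Real.log s) * (y 1 / s) = y 1
        rw [Real.exp_log hs]
        field_simp
      · refine (zorich_apply_two _).trans ?_
        show Real.exp (Real.log s) * (1 - max |y 0 / s| |y 1 / s|) = y 2
        rw [Real.exp_log hs, hmax, mul_sub, mul_div_cancel₀ _ hs.ne']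
        linarith
end

section
/- Let θ = (θ₁,θ₂,θ₃) be a unit vector in ℝ³ with θ₃ ≥ 0, and let α > 0 and β > 0. Then there exists a sequence (x_k) in ℝ³ such that ‖x_k‖ → ∞, x_k/‖x_k‖ → θ, and for every k the closed ball of radius β centered at x_k is contained in U_α. -/
open Filter

/-- The region `U_α = {(x₁,x₂,x₃) : x₃ > max (α, (x₁² + x₂²)^{1/4})}` in `ℝ³`. -/
def Ualpha (α : ℝ) : Set (EuclideanSpace ℝ (Fin 3)) :=
  {x | max α (((x 0) ^ 2 + (x 1) ^ 2) ^ ((1 : ℝ) / 4)) < x 2}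

theorem exists_seq_towards_direction_in_Ualpha
    (θ : EuclideanSpace ℝ (Fin 3)) (hθ : ‖θ‖ = 1) (hθ3 : 0 ≤ θ 2)
    (α β : ℝ) (hα : 0 < α) (hβ : 0 < β) :
    ∃ x : ℕ → EuclideanSpace ℝ (Fin 3),
      Tendsto (fun k => ‖x k‖) atTop atTop ∧
      Tendsto (fun k => (‖x k‖)⁻¹ • x k) atTop (nhds θ) ∧
      ∀ k, Metric.closedBall (x k) β ⊆ Ualpha α := by
  set N : ℕ → ℝ := fun k => (k : ℝ) + (4 + 4 * β + α) with hN
  have hNpos : ∀ k, 4 + 4 * β + α ≤ N k := fun k => by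
    have : (0 : ℝ) ≤ k := Nat.cast_nonneg k
    simp only [hN]; linarith
  have hNt : Tendsto N atTop atTop :=
    tendsto_atTop_add_const_right _ _ tendsto_natCast_atTop_atTop
  set e : EuclideanSpace ℝ (Fin 3) := EuclideanSpace.single 2 1 with he
  set y : ℕ → EuclideanSpace ℝ (Fin 3) := fun k => θ + (N k)⁻¹ • e with hy
  have hyt : Tendsto y atTop (nhds θ) := by
    have h := (tendsto_inv_atTop_zero.comp hNt).smul_const e
    simpa [hy] using h.const_add θ
  have hyn : Tendsto (fun k => ‖y k‖) atTop (nhds 1) := hθ ▸ hyt.norm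
  have hnorm : ∀ k, ‖(N k) ^ 3 • y k‖ = (N k) ^ 3 * ‖y k‖ := fun k => by
    have := hNpos k
    have h0 : 0 < N k := by linarith
    rw [norm_smul, Real.norm_of_nonneg (by positivity)]
  refine ⟨fun k => (N k) ^ 3 • y k, ?_, ?_, ?_⟩
  · simp only [hnorm]
    exact ((tendsto_pow_atTop (by norm_num)).comp hNt).atTop_mul_pos one_pos hyn
  · have h := (hyn.inv₀ one_ne_zero).smul hyt
    rw [inv_one, one_smul] at h
    refine h.congr fun k => ?_
    have := hNpos k
    have h0 : 0 < N k := by linarith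
    have h3 : (N k) ^ 3 ≠ 0 := by positivity
    simp only [hnorm]
    rw [smul_smul, mul_inv, mul_comm (((N k) ^ 3)⁻¹), mul_assoc, inv_mul_cancel₀ h3, mul_one]
  · intro k z hz
    have hk := hNpos k
    have hz : z ∈ Metric.closedBall ((N k) ^ 3 • y k) β := hz
    generalize hn : N k = n at *
    have hn0 : 0 < n := by linarith
    have hc : ∀ i, |z i - (n ^ 3 • y k) i| ≤ β := fun i => by
      have h1 := PiLp.norm_apply_le (z - n ^ 3 • y k) i
      rw [Metric.mem_closedBall, dist_eq_norm] at hz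
      exact h1.trans hz
    have hθi : ∀ i, |θ i| ≤ 1 := fun i => by
      rw [← hθ]; exact PiLp.norm_apply_le θ i
    have hz0 : |z 0| ≤ n ^ 3 + β := by
      have h := hc 0
      have hv : (n ^ 3 • y k) 0 = n ^ 3 * θ 0 := by simp [hy, he]
      rw [hv] at h
      have h2 : |n ^ 3 * θ 0| ≤ n ^ 3 := by
        rw [abs_mul, abs_of_pos (by positivity : 0 < n ^ 3)]
        exact mul_le_of_le_one_right (by positivity) (hθi 0)
      rw [abs_le] at *; constructor <;> linarith
    have hz1 : |z 1| ≤ n ^ 3 + β := by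
      have h := hc 1
      have hv : (n ^ 3 • y k) 1 = n ^ 3 * θ 1 := by simp [hy, he]
      rw [hv] at h
      have h2 : |n ^ 3 * θ 1| ≤ n ^ 3 := by
        rw [abs_mul, abs_of_pos (by positivity : 0 < n ^ 3)]
        exact mul_le_of_le_one_right (by positivity) (hθi 1)
      rw [abs_le] at *; constructor <;> linarith
    have hz2 : n ^ 2 - β ≤ z 2 := by
      have h := hc 2
      have hv : (n ^ 3 • y k) 2 = n ^ 3 * θ 2 + n ^ 2 := by
        simp [hy, he, hn]; field_simp
      rw [hv] at h
      have h2 : 0 ≤ n ^ 3 * θ 2 := by positivity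
      rw [abs_le] at h; linarith
    have hb : β ≤ n / 4 := by linarith
    have hn4 : 4 ≤ n := by linarith
    have hA : 3 / 4 * n ^ 2 + n / 2 ≤ n ^ 2 - β := by nlinarith
    have hB : 15 / 16 * n ^ 2 ≤ z 2 := by nlinarith
    have hz2p : 0 < z 2 := by nlinarith
    have hC : 2 * (n ^ 3 + β) < (z 2) ^ 2 := by
      have h1 : (15 / 16 * n ^ 2) ^ 2 ≤ (z 2) ^ 2 := by gcongr
      have h2 : 4 * n ^ 3 ≤ n ^ 4 := by nlinarith [pow_pos hn0 3]
      have h3 : 16 * n ≤ n ^ 3 := by nlinarith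
      nlinarith
    have hD : (z 0) ^ 2 + (z 1) ^ 2 < (z 2) ^ 4 := by
      have h0 := sq_le_sq' (abs_le.mp hz0).1 (abs_le.mp hz0).2
      have h1 := sq_le_sq' (abs_le.mp hz1).1 (abs_le.mp hz1).2
      have hp : 0 < n ^ 3 + β := by positivity
      have h2 : (2 * (n ^ 3 + β)) ^ 2 < ((z 2) ^ 2) ^ 2 := by gcongr
      nlinarith
    change max α (((z 0) ^ 2 + (z 1) ^ 2) ^ ((1 : ℝ) / 4)) < z 2
    refine max_lt ?_ ?_
    · have h1 : α ≤ n := by linarith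
      have h2 : 4 * n ≤ n ^ 2 := by nlinarith
      linarith
    calc ((z 0) ^ 2 + (z 1) ^ 2) ^ ((1 : ℝ) / 4) < ((z 2) ^ 4) ^ ((1 : ℝ) / 4) :=
          Real.rpow_lt_rpow (by positivity) hD (by norm_num)
      _ = z 2 := by
          rw [← Real.rpow_natCast, ← Real.rpow_mul hz2p.le]; norm_num
end

section
/- For every α > 0, the set of limiting directions of U_α equals the closed upper hemisphere: L(U_α) = {ξ ∈ S² : ξ₃ ≥ 0}. -/
open Filter

/-- The set of limiting directions of a set `A ⊆ ℝⁿ`. -/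
def limitingDirections (n : ℕ) (A : Set (EuclideanSpace ℝ (Fin n))) :
    Set (EuclideanSpace ℝ (Fin n)) :=
  {ξ | ‖ξ‖ = 1 ∧ ∃ x : ℕ → EuclideanSpace ℝ (Fin n), (∀ k, x k ∈ A) ∧
    Tendsto (fun k => ‖x k‖) atTop atTop ∧
    Tendsto (fun k => (‖x k‖)⁻¹ • x k) atTop (nhds ξ)}

theorem limitingDirections_Ualpha (α : ℝ) (hα : 0 < α) :
    limitingDirections 3 (Ualpha α) =
      {ξ : EuclideanSpace ℝ (Fin 3) | ‖ξ‖ = 1 ∧ 0 ≤ ξ 2} := by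
  ext ξ
  constructor
  · rintro ⟨h1, x, hx, -, hlim⟩
    refine ⟨h1, ?_⟩
    have hc : Tendsto (fun k => ((‖x k‖)⁻¹ • x k) 2) atTop (nhds (ξ 2)) :=
      ((EuclideanSpace.proj (𝕜 := ℝ) (2 : Fin 3)).continuous.tendsto ξ).comp hlim
    refine ge_of_tendsto' hc (fun k => ?_)
    have h2 : α < x k 2 := lt_of_le_of_lt (le_max_left _ _) (hx k)
    have h3 : 0 ≤ x k 2 := (hα.trans h2).le
    simp only [PiLp.smul_apply, smul_eq_mul]
    positivity
  · rintro ⟨h1, h2⟩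
    have hsum : ξ 0 ^ 2 + ξ 1 ^ 2 ≤ 1 := by
      have h := EuclideanSpace.norm_sq_eq ξ
      rw [h1, Fin.sum_univ_three] at h
      simp only [Real.norm_eq_abs, sq_abs] at h
      nlinarith [sq_nonneg (ξ 2)]
    let e : EuclideanSpace ℝ (Fin 3) := EuclideanSpace.single 2 1
    let t : ℕ → ℝ := fun k => (k : ℝ) + (1 + α)
    have ht : ∀ k, 0 < t k := fun k => by positivity
    have htt : Tendsto t atTop atTop :=
      tendsto_atTop_add_const_right _ _ tendsto_natCast_atTop_atTop
    let y : ℕ → EuclideanSpace ℝ (Fin 3) := fun k => ξ + ((t k)⁻¹ + (t k)⁻¹ ^ 2) • e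
    have hy : Tendsto y atTop (nhds ξ) := by
      have hi : Tendsto (fun k => (t k)⁻¹) atTop (nhds 0) := tendsto_inv_atTop_zero.comp htt
      have h := ((hi.add (hi.pow 2)).smul_const e).const_add ξ
      simpa [y] using h
    have hx0 : ∀ k, (t k ^ 2 • y k) 0 = t k ^ 2 * ξ 0 := fun k => by simp [y, e]
    have hx1 : ∀ k, (t k ^ 2 • y k) 1 = t k ^ 2 * ξ 1 := fun k => by simp [y, e]
    have hx2 : ∀ k, (t k ^ 2 • y k) 2 = t k ^ 2 * ξ 2 + (t k + 1) := fun k => by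
      have := (ht k).ne'
      simp [y, e]
      field_simp
    refine ⟨h1, fun k => t k ^ 2 • y k, fun k => ?_, ?_, ?_⟩
    · change max α (((t k ^ 2 • y k) 0 ^ 2 + (t k ^ 2 • y k) 1 ^ 2) ^ ((1 : ℝ) / 4))
        < (t k ^ 2 • y k) 2
      rw [hx0, hx1, hx2]
      have hp : 0 ≤ t k ^ 2 * ξ 2 := by positivity
      refine max_lt ?_ ?_
      · have : 0 ≤ (k : ℝ) := by positivity
        simp only [t] at hp ⊢
        linarith
      · have hle : ((t k ^ 2 * ξ 0) ^ 2 + (t k ^ 2 * ξ 1) ^ 2) ^ ((1 : ℝ) / 4) ≤ t k := by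
          have h4 : (t k ^ 2 * ξ 0) ^ 2 + (t k ^ 2 * ξ 1) ^ 2 ≤ t k ^ 4 := by
            have : 0 ≤ t k ^ 4 := by positivity
            nlinarith
          calc _ ≤ (t k ^ 4) ^ ((1 : ℝ) / 4) :=
                Real.rpow_le_rpow (by positivity) h4 (by norm_num)
            _ = t k := by
                rw [← Real.rpow_natCast, ← Real.rpow_mul (ht k).le]
                norm_num
        linarith
    · refine tendsto_atTop_mono (fun k => ?_) htt
      have h := PiLp.norm_apply_le (t k ^ 2 • y k) 2
      rw [hx2] at h
      have hp : 0 ≤ t k ^ 2 * ξ 2 := by positivity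
      have := le_abs_self (t k ^ 2 * ξ 2 + (t k + 1))
      rw [Real.norm_eq_abs] at h
      linarith
    · have h : Tendsto (fun k => (‖y k‖)⁻¹ • y k) atTop (nhds ((‖ξ‖)⁻¹ • ξ)) :=
        (hy.norm.inv₀ (by rw [h1]; norm_num)).smul hy
      rw [h1, inv_one, one_smul] at h
      refine h.congr (fun k => ?_)
      have := (ht k).ne'
      rw [norm_smul, smul_smul, Real.norm_of_nonneg (by positivity)]
      congr 1
      field_simp
end
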